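/- Quadratic growth implies condition (φ_B): let φ : [0,∞) → [0,∞) be continuous, strictly increasing with φ(t) ≥ t for all t, and suppose there exist s₀ > 0 and C > 0 such that φ(s) ≤ C·s² for all s ≥ s₀. Then for every ε > 0 and every M > 0 there exists ν₀ > 0 such that for all ν ≥ ν₀, every continuous nonincreasing f : [0,ε] → [0,∞) with f(0) = ν which satisfies f′(t) = −φ(f(t)) at every t where f(t) > 0 has ∫₀^ε f(t) dt ≥ M. In particular, φ satisfies condition (φ_B). -/

import Mathlib

open Metric Set Filter MeasureTheory
open scoped Topology RealInnerProductSpace Classical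

noncomputable section

/-- Euclidean space `ℝⁿ`. -/
abbrev Eucl (n : ℕ) := EuclideanSpace ℝ (Fin n)

/-- Real `n × n` matrices. -/
abbrev Mat (n : ℕ) := Matrix (Fin n) (Fin n) ℝ

variable {n : ℕ}

/-- Eigenvalues of a matrix (junk value `0` if the matrix is not symmetric). -/
noncomputable def eigenvals (X : Mat n) : Fin n → ℝ :=
  if h : X.IsHermitian then h.eigenvalues else 0

/-- The Pucci maximal operator `P⁺_{λ,Λ}(X) = -λ Σ_{eᵢ ≥ 0} eᵢ - Λ Σ_{eᵢ < 0} eᵢ`. -/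
noncomputable def pucciPlus (lam Lam : ℝ) (X : Mat n) : ℝ :=
  ∑ i, (if 0 ≤ eigenvals X i then -(lam * eigenvals X i) else -(Lam * eigenvals X i))

/-- The Pucci minimal operator `P⁻_{λ,Λ}(X) = -Λ Σ_{eᵢ ≥ 0} eᵢ - λ Σ_{eᵢ < 0} eᵢ`. -/
noncomputable def pucciMinus (lam Lam : ℝ) (X : Mat n) : ℝ :=
  ∑ i, (if 0 ≤ eigenvals X i then -(Lam * eigenvals X i) else -(lam * eigenvals X i))

/-- The positive semidefinite order `X ≤ Y` on symmetric matrices. -/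
def matLE (X Y : Mat n) : Prop := (Y - X).PosSemidef

/-- Structure condition (F1): `F(x,u,p,X) ≥ F(x,v,p,Y)` whenever `u ≥ v` and `X ≤ Y`. -/
def CondF1 (F : Eucl n → ℝ → Eucl n → Mat n → ℝ) : Prop :=
  ∀ x u v p X Y, v ≤ u → matLE X Y → F x v p Y ≤ F x u p X

/-- Structure condition (F2A): `-F(x,0,p,X) ≤ φ(|p|) - P⁻_{λ,Λ}(X)`. -/
def CondF2A (lam Lam : ℝ) (φ : ℝ → ℝ) (F : Eucl n → ℝ → Eucl n → Mat n → ℝ) : Prop :=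
  ∀ x p X, X.IsHermitian → -F x 0 p X ≤ φ ‖p‖ - pucciMinus lam Lam X

/-- Structure condition (F2B): `F(x,0,p,X) ≤ φ(|p|) + P⁺_{λ,Λ}(X)`. -/
def CondF2B (lam Lam : ℝ) (φ : ℝ → ℝ) (F : Eucl n → ℝ → Eucl n → Mat n → ℝ) : Prop :=
  ∀ x p X, X.IsHermitian → F x 0 p X ≤ φ ‖p‖ + pucciPlus lam Lam X

/-- Structure condition (F2B*): `F(x,r,p,X) ≤ φ(|p|) + P⁺_{λ,Λ}(X) + γ(r)` for `r > 0`. -/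
def CondF2Bstar (lam Lam : ℝ) (φ γF : ℝ → ℝ) (F : Eucl n → ℝ → Eucl n → Mat n → ℝ) : Prop :=
  ∀ x (r : ℝ) p X, 0 < r → X.IsHermitian →
    F x r p X ≤ φ ‖p‖ + pucciPlus lam Lam X + γF r

/-- `γ` is nonnegative and dominated by `φ`: `γ(r) ≤ C* φ(r)` whenever `0 < r ≤ 1`. -/
def GammaDominated (Cstar : ℝ) (φ γF : ℝ → ℝ) : Prop :=
  (∀ r : ℝ, 0 < r → 0 ≤ γF r) ∧ ∀ r : ℝ, 0 < r → r ≤ 1 → γF r ≤ Cstar * φ r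

/-- Standing assumptions on `φ : [0,∞) → [0,∞)`: continuous, strictly increasing and
`φ(t) ≥ t`. -/
def PhiAdmissible (φ : ℝ → ℝ) : Prop :=
  ContinuousOn φ (Ici 0) ∧ StrictMonoOn φ (Ici 0) ∧ ∀ t : ℝ, 0 ≤ t → t ≤ φ t

/-- The Osgood condition (φ_A): `∫₀¹ dt / φ(t) = ∞`, as divergence of the improper
Riemann integral. -/
def OsgoodCondition (φ : ℝ → ℝ) : Prop :=
  Tendsto (fun ε : ℝ => ∫ t in ε..1, 1 / φ t) (𝓝[>] 0) atTop

/-- Condition (φ_B): for every sufficiently small `ε > 0`, `∫₀^ε f_ν(t) dt → ∞` as `ν → ∞`,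
where `f_ν` solves `f' = -φ(f)`, `f(0) = ν`. -/
def CondPhiB (φ : ℝ → ℝ) : Prop :=
  ∃ ε₀ > (0:ℝ), ∀ ε : ℝ, 0 < ε → ε ≤ ε₀ → ∀ M : ℝ, 0 < M → ∃ ν₀ > (0:ℝ), ∀ ν : ℝ, ν₀ ≤ ν →
    ∀ f : ℝ → ℝ, (∀ t ∈ Icc (0:ℝ) ε, 0 ≤ f t) → f 0 = ν →
      (∀ t ∈ Icc (0:ℝ) ε, HasDerivAt f (-φ (f t)) t) →
      M ≤ ∫ t in (0:ℝ)..ε, f t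

/-- The Hessian matrix of a real valued function on Euclidean space. -/
noncomputable def hess (ψ : Eucl n → ℝ) (x : Eucl n) : Mat n :=
  Matrix.of fun i j =>
    iteratedFDeriv ℝ 2 ψ x ![EuclideanSpace.single i 1, EuclideanSpace.single j 1]

/-- Viscosity subsolution of `F(x,u,Du,D²u) = 0` in the open set `Ω`. -/
def ViscositySubsolution (F : Eucl n → ℝ → Eucl n → Mat n → ℝ) (Ω : Set (Eucl n))
    (u : Eucl n → ℝ) : Prop :=
  ∀ ψ : Eucl n → ℝ, ContDiffOn ℝ 2 ψ Ω → ∀ x₀ ∈ Ω,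
    IsLocalMaxOn (fun x => u x - ψ x) Ω x₀ →
    F x₀ (u x₀) (gradient ψ x₀) (hess ψ x₀) ≤ 0

/-- Viscosity supersolution of `F(x,u,Du,D²u) = 0` in the open set `Ω`. -/
def ViscositySupersolution (F : Eucl n → ℝ → Eucl n → Mat n → ℝ) (Ω : Set (Eucl n))
    (v : Eucl n → ℝ) : Prop :=
  ∀ ψ : Eucl n → ℝ, ContDiffOn ℝ 2 ψ Ω → ∀ x₀ ∈ Ω,
    IsLocalMinOn (fun x => v x - ψ x) Ω x₀ →
    0 ≤ F x₀ (v x₀) (gradient ψ x₀) (hess ψ x₀)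

/-- Strict classical (twice differentiable) subsolution on an open set. -/
def StrictClassicalSubsolution (F : Eucl n → ℝ → Eucl n → Mat n → ℝ) (Ω : Set (Eucl n))
    (u : Eucl n → ℝ) : Prop :=
  ContDiffOn ℝ 2 u Ω ∧ ∀ x ∈ Ω, F x (u x) (gradient u x) (hess u x) < 0

/-- Strict classical (twice differentiable) supersolution on an open set. -/
def StrictClassicalSupersolution (F : Eucl n → ℝ → Eucl n → Mat n → ℝ) (Ω : Set (Eucl n))
    (v : Eucl n → ℝ) : Prop :=
  ContDiffOn ℝ 2 v Ω ∧ ∀ x ∈ Ω, 0 < F x (v x) (gradient v x) (hess v x)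

/-- The interior ball condition at a boundary point `w` with radius `ri`. -/
def InteriorBallAt (Ω : Set (Eucl n)) (w : Eucl n) (ri : ℝ) : Prop :=
  ∃ y, ball y ri ⊆ Ω ∧ sphere y ri ∩ frontier Ω = {w}

/-- The interior ball condition (for all boundary points). -/
def InteriorBallCondition (Ω : Set (Eucl n)) (ri : ℝ) : Prop :=
  ∀ w ∈ frontier Ω, InteriorBallAt Ω w ri

/-- The exterior ball condition at a boundary point `w` with radius `re`. -/
def ExteriorBallAt (Ω : Set (Eucl n)) (w : Eucl n) (re : ℝ) : Prop :=
  ∃ y, ball y re ⊆ Ωᶜ ∧ sphere y re ∩ frontier Ω = {w}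

/-- The exterior ball condition (for all boundary points). -/
def ExteriorBallCondition (Ω : Set (Eucl n)) (re : ℝ) : Prop :=
  ∀ w ∈ frontier Ω, ExteriorBallAt Ω w re

/-- The ball condition: both the interior and the exterior ball condition. -/
def BallCondition (Ω : Set (Eucl n)) (rb : ℝ) : Prop :=
  InteriorBallCondition Ω rb ∧ ExteriorBallCondition Ω rb

/-- The annulus `B(y,R) ∖ closure B(y,r)`. -/
def annulus (y : Eucl n) (r R : ℝ) : Set (Eucl n) := ball y R \ closedBall y r

/-- A nonnegative antitone function which is differentiable wherever it is positive has a right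
derivative everywhere, equal to `0` at its zeros. -/
lemma hasDerivWithinAt_Ici_of_antitoneOn {f f' : ℝ → ℝ} {ε x : ℝ}
    (hanti : AntitoneOn f (Icc 0 ε)) (hnonneg : ∀ t ∈ Icc (0:ℝ) ε, 0 ≤ f t)
    (hderiv : ∀ t ∈ Icc (0:ℝ) ε, 0 < f t → HasDerivAt f (f' t) t) (hx : x ∈ Ico (0:ℝ) ε) :
    HasDerivWithinAt f (if 0 < f x then f' x else 0) (Ici x) x := by
  have hx' : x ∈ Icc (0:ℝ) ε := Ico_subset_Icc_self hx
  split_ifs with hpos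
  · exact (hderiv x hx' hpos).hasDerivWithinAt
  · have hzero : f x = 0 := le_antisymm (not_lt.1 hpos) (hnonneg x hx')
    refine (hasDerivWithinAt_const x (Ici x) (0:ℝ)).congr_of_eventuallyEq ?_ hzero
    filter_upwards [Icc_mem_nhdsGE hx.2] with z hz
    have hz' : z ∈ Icc (0:ℝ) ε := ⟨hx.1.trans hz.1, hz.2⟩
    exact le_antisymm (hzero ▸ hanti hx' hz' hz.1) (hnonneg z hz')

/-- The reciprocal of a positive affine function solves `g' = -K g²`. -/
lemma hasDerivAt_inv_add_mul {a K t : ℝ} (h : a + K * t ≠ 0) :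
    HasDerivAt (fun t : ℝ => (a + K * t)⁻¹) (-(K * ((a + K * t)⁻¹) ^ 2)) t := by
  have h1 : HasDerivAt (fun t : ℝ => a + K * t) K t := by
    simpa using ((hasDerivAt_id t).const_mul K).const_add a
  exact (h1.fun_inv h).congr_deriv (by field_simp)

lemma integral_inv_add_mul {a K δ : ℝ} (ha : 0 < a) (hK : 0 < K) (hδ : 0 ≤ δ) :
    ∫ t in (0:ℝ)..δ, (a + K * t)⁻¹ = (Real.log (a + K * δ) - Real.log a) / K := by
  have hpos : ∀ t ∈ uIcc 0 δ, 0 < a + K * t := fun t ht => by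
    rw [uIcc_of_le hδ] at ht
    have := mul_nonneg hK.le ht.1
    linarith
  have hderiv : ∀ t ∈ uIcc 0 δ,
      HasDerivAt (fun t : ℝ => Real.log (a + K * t) / K) (a + K * t)⁻¹ t := fun t ht => by
    have h1 : HasDerivAt (fun t : ℝ => a + K * t) K t := by
      simpa using ((hasDerivAt_id t).const_mul K).const_add a
    exact ((h1.log (hpos t ht).ne').div_const K).congr_deriv (by field_simp)
  rw [intervalIntegral.integral_eq_sub_of_hasDerivAt hderiv]
  · simp [sub_div]
  · refine ContinuousOn.intervalIntegrable fun t ht => ?_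
    exact (hasDerivAt_inv_add_mul (hpos t ht).ne').continuousAt.continuousWithinAt

/-- Comparison of a solution of `f' = -φ(f)` with the explicit solution of `g' = -K g²`, as long
as the latter stays in the range where `φ(s) < K s²`. -/
lemma inv_add_mul_le_of_deriv_eq_neg {φ f : ℝ → ℝ} {s₀ K ν δ ε : ℝ} (hs₀ : 0 < s₀) (hK : 0 < K)
    (hν : 0 < ν) (hquad : ∀ s : ℝ, s₀ ≤ s → φ s < K * s ^ 2) (hδε : δ ≤ ε)
    (hδ : ν⁻¹ + K * δ ≤ s₀⁻¹)
    (hcont : ContinuousOn f (Icc 0 ε)) (hanti : AntitoneOn f (Icc 0 ε))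
    (hnonneg : ∀ t ∈ Icc (0:ℝ) ε, 0 ≤ f t) (hf0 : f 0 = ν)
    (hderiv : ∀ t ∈ Icc (0:ℝ) ε, 0 < f t → HasDerivAt f (-φ (f t)) t) :
    ∀ t ∈ Icc (0:ℝ) δ, (ν⁻¹ + K * t)⁻¹ ≤ f t := by
  have hpos : ∀ t ∈ Icc (0:ℝ) δ, 0 < ν⁻¹ + K * t := fun t ht => by
    have := mul_nonneg hK.le ht.1
    positivity
  have hg : ∀ t ∈ Icc (0:ℝ) δ, HasDerivAt (fun t : ℝ => (ν⁻¹ + K * t)⁻¹)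
      (-(K * ((ν⁻¹ + K * t)⁻¹) ^ 2)) t := fun t ht => hasDerivAt_inv_add_mul (hpos t ht).ne'
  intro t ht
  refine neg_le_neg_iff.1 (image_le_of_deriv_right_lt_deriv_boundary'
    (f := fun t => -f t) (f' := fun x => -(if 0 < f x then -φ (f x) else 0))
    (B := fun t => -(ν⁻¹ + K * t)⁻¹) (B' := fun t => K * ((ν⁻¹ + K * t)⁻¹) ^ 2)
    (hcont.mono (Icc_subset_Icc_right hδε)).neg ?_ ?_ ?_ ?_ ?_ ht)
  · intro x hx
    exact (hasDerivWithinAt_Ici_of_antitoneOn hanti hnonneg hderiv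
      (Ico_subset_Ico_right hδε hx)).neg
  · simp [hf0]
  · exact fun x hx => (hg x hx).neg.continuousAt.continuousWithinAt
  · intro x hx
    exact ((hg x (Ico_subset_Icc_self hx)).fun_neg.congr_deriv (neg_neg _)).hasDerivWithinAt
  · intro x hx heq
    have heq' : f x = (ν⁻¹ + K * x)⁻¹ := neg_injective heq
    have hx' := Ico_subset_Icc_self hx
    have hle : s₀ ≤ f x := by
      rw [heq', le_inv_comm₀ hs₀ (hpos x hx')]
      exact le_trans (by have := mul_le_mul_of_nonneg_left hx'.2 hK.le; linarith) hδ
    simp only [if_pos (hs₀.trans_le hle), neg_neg, ← heq']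
    exact hquad _ hle

/-- Quadratic growth forces the integrals of the solutions of `f' = -φ(f)`, `f(0) = ν`, to diverge
as `ν → ∞`. -/
lemma exists_forall_le_integral_of_quadratic_growth {φ : ℝ → ℝ} {s₀ C : ℝ} (hs₀ : 0 < s₀)
    (hC : 0 < C) (hquad : ∀ s : ℝ, s₀ ≤ s → φ s ≤ C * s ^ 2) {ε : ℝ} (hε : 0 < ε) (M : ℝ) :
    ∃ ν₀ > (0:ℝ), ∀ ν : ℝ, ν₀ ≤ ν →
      ∀ f : ℝ → ℝ, ContinuousOn f (Icc 0 ε) → AntitoneOn f (Icc 0 ε) →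
        (∀ t ∈ Icc (0:ℝ) ε, 0 ≤ f t) → f 0 = ν →
        (∀ t ∈ Icc (0:ℝ) ε, 0 < f t → HasDerivAt f (-φ (f t)) t) →
        M ≤ ∫ t in (0:ℝ)..ε, f t := by
  have hK : 0 < 2 * C := by positivity
  set K := 2 * C with hKdef
  obtain ⟨δ, hδ, hδε, hδs⟩ : ∃ δ > 0, δ ≤ ε ∧ K * δ ≤ (2 * s₀)⁻¹ := by
    refine ⟨min ε ((2 * s₀)⁻¹ / K), by positivity, min_le_left _ _, ?_⟩
    calc K * min ε ((2 * s₀)⁻¹ / K) ≤ K * ((2 * s₀)⁻¹ / K) := by gcongr; exact min_le_right _ _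
      _ = (2 * s₀)⁻¹ := by field_simp
  refine ⟨max (2 * s₀) (Real.exp (K * M) / (K * δ)), by positivity, ?_⟩
  intro ν hν f hcont hanti hnonneg hf0 hderiv
  have hν1 : 2 * s₀ ≤ ν := (le_max_left _ _).trans hν
  have hν2 : Real.exp (K * M) / (K * δ) ≤ ν := (le_max_right _ _).trans hν
  have hνpos : 0 < ν := lt_of_lt_of_le (by positivity) hν1
  have hstrict : ∀ s : ℝ, s₀ ≤ s → φ s < K * s ^ 2 := fun s hs => by
    have : 0 < C * s ^ 2 := mul_pos hC (pow_pos (hs₀.trans_le hs) 2)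
    linarith [hquad s hs]
  have hbound : ν⁻¹ + K * δ ≤ s₀⁻¹ := by
    have h1 : ν⁻¹ ≤ (2 * s₀)⁻¹ := inv_anti₀ (by positivity) hν1
    have h2 : (2 * s₀)⁻¹ + (2 * s₀)⁻¹ = s₀⁻¹ := by field_simp; norm_num
    linarith
  have hcomp := inv_add_mul_le_of_deriv_eq_neg hs₀ hK hνpos hstrict hδε hbound hcont hanti
    hnonneg hf0 hderiv
  have hint : IntervalIntegrable f volume 0 ε :=
    (hcont.mono (uIcc_of_le hε.le).subset).intervalIntegrable
  have hsub : uIcc 0 δ ⊆ Icc 0 ε := by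
    rw [uIcc_of_le hδ.le]; exact Icc_subset_Icc_right hδε
  have hgint : IntervalIntegrable (fun t : ℝ => (ν⁻¹ + K * t)⁻¹) volume 0 δ := by
    refine ContinuousOn.intervalIntegrable fun t ht => ?_
    rw [uIcc_of_le hδ.le] at ht
    have := mul_nonneg hK.le ht.1
    have hne : ν⁻¹ + K * t ≠ 0 := by positivity
    exact (hasDerivAt_inv_add_mul hne).continuousAt.continuousWithinAt
  have hlog : K * M ≤ Real.log (ν⁻¹ + K * δ) - Real.log ν⁻¹ := by
    rw [← Real.log_div (by positivity) (by positivity), Real.le_log_iff_exp_le (by positivity)]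
    rw [div_le_iff₀ (by positivity)] at hν2
    have : (ν⁻¹ + K * δ) / ν⁻¹ = 1 + ν * (K * δ) := by field_simp
    linarith
  calc M ≤ (Real.log (ν⁻¹ + K * δ) - Real.log ν⁻¹) / K := by
        rw [le_div_iff₀ hK]; linarith
    _ = ∫ t in (0:ℝ)..δ, (ν⁻¹ + K * t)⁻¹ := (integral_inv_add_mul (by positivity) hK hδ.le).symm
    _ ≤ ∫ t in (0:ℝ)..δ, f t :=
        intervalIntegral.integral_mono_on hδ.le hgint (hcont.mono hsub).intervalIntegrable hcomp
    _ ≤ ∫ t in (0:ℝ)..ε, f t := by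
        refine intervalIntegral.integral_mono_interval le_rfl hδ.le hδε ?_ hint
        filter_upwards [ae_restrict_mem measurableSet_Ioc] with t ht
        exact hnonneg t (Ioc_subset_Icc_self ht)

/-- Remark 5.5: quadratic growth of `φ` implies condition (φ_B). -/
theorem quadratic_growth_implies_phiB
    (φ : ℝ → ℝ) (hφ : PhiAdmissible φ)
    (s₀ C : ℝ) (hs₀ : 0 < s₀) (hC : 0 < C)
    (hquad : ∀ s : ℝ, s₀ ≤ s → φ s ≤ C * s^2) :
    (∀ ε : ℝ, 0 < ε → ∀ M : ℝ, 0 < M → ∃ ν₀ > (0:ℝ), ∀ ν : ℝ, ν₀ ≤ ν →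
      ∀ f : ℝ → ℝ, ContinuousOn f (Icc 0 ε) → AntitoneOn f (Icc 0 ε) →
        (∀ t ∈ Icc (0:ℝ) ε, 0 ≤ f t) → f 0 = ν →
        (∀ t ∈ Icc (0:ℝ) ε, 0 < f t → HasDerivAt f (-φ (f t)) t) →
        M ≤ ∫ t in (0:ℝ)..ε, f t) ∧
    CondPhiB φ := by
  have hmain := fun (ε : ℝ) (hε : 0 < ε) (M : ℝ) (_ : 0 < M) =>
    exists_forall_le_integral_of_quadratic_growth hs₀ hC hquad hε M
  refine ⟨hmain, 1, one_pos, fun ε hε _ M hM => ?_⟩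
  obtain ⟨ν₀, hν₀, h⟩ := hmain ε hε M hM
  refine ⟨ν₀, hν₀, fun ν hν f hnonneg hf0 hderiv => ?_⟩
  have hcont : ContinuousOn f (Icc 0 ε) :=
    fun t ht => (hderiv t ht).continuousAt.continuousWithinAt
  refine h ν hν f hcont ?_ hnonneg hf0 fun t ht _ => hderiv t ht
  refine antitoneOn_of_hasDerivWithinAt_nonpos (convex_Icc 0 ε) hcont
    (fun t ht => (hderiv t (interior_subset ht)).hasDerivWithinAt) fun t ht => ?_
  have hft := hnonneg t (interior_subset ht)
  exact neg_nonpos.2 (hft.trans (hφ.2.2 _ hft))
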